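/- arXiv:1911.09866 — 2 statements merged into one kernel-verified Lean document; each statement's English description precedes it below -/
import Mathlib

section
/- Let 1 ≤ b < n/2 − 1 and let T be an n-vertex chemical tree with exactly b branching vertices such that either M1(T') ≤ M1(T) for every n-vertex chemical tree T' with exactly b branching vertices, or M2(T') ≤ M2(T) for every n-vertex chemical tree T' with exactly b branching vertices. Then T contains at least one vertex of degree 2 if and only if b < (n−2)/3. -/
open SimpleGraph

namespace ChemTree

variable {V : Type*}

/-- The degree of a vertex. -/
noncomputable def deg (G : SimpleGraph V) (v : V) : ℕ :=
  (G.neighborSet v).ncard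

/-- A chemical tree: a tree in which every vertex has degree at most 4. -/
def IsChemicalTree (G : SimpleGraph V) : Prop :=
  G.IsTree ∧ ∀ v, deg G v ≤ 4

/-- `nDeg G i` is the number of vertices of `G` having degree `i`. -/
noncomputable def nDeg (G : SimpleGraph V) (i : ℕ) : ℕ :=
  {v | deg G v = i}.ncard

/-- The first Zagreb index. -/
noncomputable def M1 (G : SimpleGraph V) [Fintype V] : ℕ :=
  ∑ v, (deg G v) ^ 2

/-- The second Zagreb index. -/
noncomputable def M2 (G : SimpleGraph V) [Fintype V] : ℕ :=
  ∑ e ∈ (Set.toFinite G.edgeSet).toFinset,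
    Sym2.lift ⟨fun u w => deg G u * deg G w, fun u w => Nat.mul_comm _ _⟩ e

/-- A segment: a nontrivial path whose end vertices have degree `≠ 2` and whose
internal vertices all have degree `2`. -/
def IsSegment (G : SimpleGraph V) {u v : V} (p : G.Walk u v) : Prop :=
  p.IsPath ∧ 0 < p.length ∧ deg G u ≠ 2 ∧ deg G v ≠ 2 ∧
    ∀ w ∈ p.support, w ≠ u → w ≠ v → deg G w = 2

/-- The number of segments: in a tree, a segment is uniquely determined by the
unordered pair of its end vertices. -/
noncomputable def numSegments (G : SimpleGraph V) : ℕ :=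
  {s : Sym2 V | ∃ (u v : V) (p : G.Walk u v), s = s(u, v) ∧ IsSegment G p}.ncard

/-- The number of branching vertices (vertices of degree at least 3). -/
noncomputable def numBranching (G : SimpleGraph V) : ℕ :=
  {v | 3 ≤ deg G v}.ncard

/-- An internal path: both end vertices are branching and all internal vertices
have degree `2`. -/
def IsInternalPath (G : SimpleGraph V) {u v : V} (p : G.Walk u v) : Prop :=
  p.IsPath ∧ 0 < p.length ∧ 3 ≤ deg G u ∧ 3 ≤ deg G v ∧
    ∀ w ∈ p.support, w ≠ u → w ≠ v → deg G w = 2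

/-- A pendent path: one end vertex is pendent, the other is branching and all
internal vertices have degree `2`. -/
def IsPendentPath (G : SimpleGraph V) {u v : V} (p : G.Walk u v) : Prop :=
  p.IsPath ∧ 0 < p.length ∧ deg G u = 1 ∧ 3 ≤ deg G v ∧
    ∀ w ∈ p.support, w ≠ u → w ≠ v → deg G w = 2

end ChemTree

open ChemTree

namespace ChemTree

open Classical

section

variable {V : Type*} [Fintype V]

lemma deg_eq_degree (G : SimpleGraph V) (v : V) : deg G v = G.degree v := by
  rw [deg, Set.ncard_eq_toFinset_card', ← G.card_neighborFinset_eq_degree, neighborFinset]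

lemma deg_eq_sum (G : SimpleGraph V) (v : V) : (deg G v : ℤ) = ∑ w, G.adjMatrix ℤ v w := by
  rw [deg_eq_degree]
  simp [adjMatrix_apply, degree, neighborFinset_eq_filter]

lemma sum_deg (G : SimpleGraph V) (hG : G.IsTree) :
    ∑ v, deg G v + 2 = 2 * Fintype.card V := by
  simp only [deg_eq_degree, G.sum_degrees_eq_twice_card_edges]
  have := hG.card_edgeFinset
  omega

lemma numBranching_eq_sum (G : SimpleGraph V) :
    numBranching G = ∑ v, if 3 ≤ deg G v then 1 else 0 := by
  rw [numBranching, Set.ncard_eq_toFinset_card']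
  simp

/-- Twice the second Zagreb index is the quadratic form of the adjacency matrix at the
degree sequence. -/
lemma two_mul_M2 (G : SimpleGraph V) :
    (2 * M2 G : ℤ) = ∑ a, ∑ b, G.adjMatrix ℤ a b * (deg G a * deg G b) := by
  have hE : (Set.toFinite G.edgeSet).toFinset = G.edgeFinset := by ext; simp
  have h1 : ∑ a, ∑ b, G.adjMatrix ℤ a b * (deg G a * deg G b) =
      ∑ p ∈ (Finset.univ : Finset (V × V)) with G.Adj p.1 p.2,
        (deg G p.1 * deg G p.2 : ℤ) := by
    rw [Finset.sum_filter, Fintype.sum_prod_type]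
    simp [adjMatrix_apply]
  rw [h1, ← Finset.sum_fiberwise_of_maps_to (t := G.edgeFinset) (g := fun p => s(p.1, p.2))
    (by simp), M2, hE]
  push_cast
  rw [Finset.mul_sum]
  refine Finset.sum_congr rfl fun e he => ?_
  induction e with
  | h x y =>
    have hxy : G.Adj x y := by simpa using he
    have hf : ((Finset.univ.filter fun p : V × V => G.Adj p.1 p.2).filter
        fun p => s(p.1, p.2) = s(x, y)) = {(x, y), (y, x)} := by
      ext ⟨a, b⟩
      simp only [Finset.mem_filter, Finset.mem_univ, true_and, Sym2.eq_iff,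
        Finset.mem_insert, Finset.mem_singleton, Prod.mk.injEq]
      constructor
      · exact fun h => h.2
      · rintro (⟨rfl, rfl⟩ | ⟨rfl, rfl⟩)
        · exact ⟨hxy, .inl ⟨rfl, rfl⟩⟩
        · exact ⟨hxy.symm, .inr ⟨rfl, rfl⟩⟩
    rw [hf, Finset.sum_pair (by simp [hxy.ne])]
    simp only [Sym2.lift_mk]
    push_cast
    ring

end

variable {V : Type*}

/-- The graph obtained by replacing the edge `uy` by the edge `vy`. -/
def swapEdge (T : SimpleGraph V) (u v y : V) : SimpleGraph V :=
  T.deleteEdges {s(u, y)} ⊔ edge v y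

lemma swapEdge_isTree {T : SimpleGraph V} (hT : T.IsTree) {u v y : V} (huy : T.Adj u y)
    (huv : (T.deleteEdges {s(u, y)}).Reachable u v) (hvy : v ≠ y) :
    (swapEdge T u v y).IsTree := by
  have hbr : ¬ (T.deleteEdges {s(u, y)}).Reachable u y :=
    isBridge_iff.mp (isAcyclic_iff_forall_isBridge.mp hT.isAcyclic huy)
  have hacyc : (swapEdge T u v y).IsAcyclic :=
    (hT.isAcyclic.anti (deleteEdges_le _)).sup_edge_of_not_reachable
      fun h => hbr (huv.trans h)
  have hle : T.deleteEdges {s(u, y)} ≤ swapEdge T u v y := le_sup_left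
  have hr : (swapEdge T u v y).Reachable u y :=
    (huv.mono hle).trans (Adj.reachable (Or.inr (by simp [edge_adj, hvy])))
  have hadj : ∀ a b, T.Adj a b → (swapEdge T u v y).Reachable a b := by
    intro a b hab
    by_cases h : s(a, b) = s(u, y)
    · rcases Sym2.eq_iff.mp h with ⟨rfl, rfl⟩ | ⟨rfl, rfl⟩
      · exact hr
      · exact hr.symm
    · exact Adj.reachable (hle (by simpa [deleteEdges_adj] using ⟨hab, by simpa using h⟩))
  have hpre : (swapEdge T u v y).Preconnected := by
    intro a b
    obtain ⟨p⟩ := hT.connected.preconnected a b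
    induction p with
    | nil => rfl
    | cons h _ ih => exact (hadj _ _ h).trans ih
  have : Nonempty V := ⟨u⟩
  exact ⟨⟨hpre⟩, hacyc⟩

/-- A vertex `u` of degree at least two has a neighbour whose removal keeps it joined to a
given other vertex. -/
lemma exists_adj_reachable_deleteEdges {T : SimpleGraph V} (hT : T.Connected) {u v : V}
    (huv : u ≠ v) (hu : 1 < deg T u) :
    ∃ y, T.Adj u y ∧ (T.deleteEdges {s(u, y)}).Reachable u v := by
  obtain ⟨p, hp⟩ := hT.exists_isPath u v
  cases p with
  | nil => exact absurd rfl huv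
  | @cons _ x _ h q =>
    obtain ⟨y, hy, hyx⟩ := Set.exists_ne_of_one_lt_ncard hu x
    refine ⟨y, hy, ⟨(Walk.cons h q).toDeleteEdges _ fun e he hs => ?_⟩⟩
    obtain rfl : e = s(u, y) := hs
    rw [Walk.edges_cons, List.mem_cons] at he
    rcases he with he | he
    · simp [hyx] at he
      exact huv.elim (by simp_all)
    · exact ((Walk.cons_isPath_iff h q).mp hp).2 (q.fst_mem_support_of_mem_edges he)

lemma swapEdge_adjMatrix {T : SimpleGraph V} {u v y : V} (huy : T.Adj u y)
    (hvy : v ≠ y) (hvu : v ≠ u) (hnadj : ¬ T.Adj v y) (a b : V) :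
    (swapEdge T u v y).adjMatrix ℤ a b = T.adjMatrix ℤ a b
      - ((if a = u then 1 else 0) * (if b = y then 1 else 0)
        + (if a = y then 1 else 0) * (if b = u then 1 else 0))
      + ((if a = v then 1 else 0) * (if b = y then 1 else 0)
        + (if a = y then 1 else 0) * (if b = v then 1 else 0)) := by
  have h1 := huy.ne
  have h2 := huy.symm
  have h3 : ¬ T.Adj y v := fun h => hnadj h.symm
  have hadj : (swapEdge T u v y).Adj a b ↔
      T.Adj a b ∧ ¬ (a = u ∧ b = y ∨ a = y ∧ b = u) ∨ (a = v ∧ b = y ∨ a = y ∧ b = v) := by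
    simp only [swapEdge, sup_adj, deleteEdges_adj, edge_adj, Set.mem_singleton_iff, Sym2.eq_iff]
    grind
  simp only [adjMatrix_apply, hadj]
  clear hadj
  by_cases hau : a = u <;> by_cases hav : a = v <;> by_cases hay : a = y <;>
  by_cases hbu : b = u <;> by_cases hbv : b = v <;> by_cases hby : b = y <;>
  simp_all

variable [Fintype V]

lemma one_le_deg {T : SimpleGraph V} (hT : T.Connected) [Nontrivial V] (v : V) :
    1 ≤ deg T v := by
  rw [deg_eq_degree]
  exact hT.preconnected.degree_pos_of_nontrivial v

/-- In a chemical tree with a vertex of degree two and a vertex of degree three, one edge swap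
increases both Zagreb indices while keeping the set of branching vertices. -/
lemma exists_larger_of_deg_two_of_deg_three {T : SimpleGraph V} (hT : IsChemicalTree T)
    {u v : V} (hu : deg T u = 2) (hv : deg T v = 3) :
    ∃ T' : SimpleGraph V, IsChemicalTree T' ∧ numBranching T' = numBranching T ∧
      M1 T < M1 T' ∧ M2 T < M2 T' := by
  have huv : u ≠ v := by rintro rfl; omega
  have : Nontrivial V := ⟨u, v, huv⟩
  obtain ⟨y, huy, hr⟩ := exists_adj_reachable_deleteEdges hT.1.connected huv (by omega)
  have hbr : ¬ (T.deleteEdges {s(u, y)}).Reachable u y :=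
    isBridge_iff.mp (isAcyclic_iff_forall_isBridge.mp hT.1.isAcyclic huy)
  have hvy : v ≠ y := by rintro rfl; exact hbr hr
  have hnadj : ¬ T.Adj v y := fun h => hbr <| hr.trans <| Adj.reachable <| by
    simp [deleteEdges_adj, h, huv.symm, hvy]
  have hA := swapEdge_adjMatrix huy hvy huv.symm hnadj
  have hd : ∀ a, (deg (swapEdge T u v y) a : ℤ) =
      deg T a - (if a = u then 1 else 0) + (if a = v then 1 else 0) := by
    intro a
    simp only [deg_eq_sum, hA, Finset.sum_add_distrib, Finset.sum_sub_distrib,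
      ← Finset.mul_sum, Finset.sum_ite_eq', Finset.mem_univ, if_true]
    ring
  have hdu : deg (swapEdge T u v y) u = 1 := by
    have := hd u; simp [huv, hu] at this; omega
  have hdv : deg (swapEdge T u v y) v = 4 := by
    have := hd v; simp [huv.symm, hv] at this; omega
  have hdo : ∀ a, a ≠ u → a ≠ v → deg (swapEdge T u v y) a = deg T a := by
    intro a h1 h2
    have := hd a; simp [h1, h2] at this; omega
  have h1 := one_le_deg hT.1.connected
  refine ⟨swapEdge T u v y, ⟨swapEdge_isTree hT.1 huy hr hvy, fun a => ?_⟩, ?_, ?_, ?_⟩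
  · by_cases hau : a = u
    · subst hau; omega
    by_cases hav : a = v
    · subst hav; omega
    rw [hdo a hau hav]; exact hT.2 a
  · unfold numBranching
    congr 1
    ext a
    simp only [Set.mem_ofPred_eq]
    by_cases hau : a = u
    · subst hau; omega
    by_cases hav : a = v
    · subst hav; omega
    rw [hdo a hau hav]
  · have key : (M1 (swapEdge T u v y) : ℤ) = M1 T + 4 := by
      have : ∀ a, ((deg (swapEdge T u v y) a : ℤ)) ^ 2 = (deg T a : ℤ) ^ 2
          - (if a = u then 3 else 0) + (if a = v then 7 else 0) := by
        intro a
        by_cases hau : a = u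
        · subst hau; simp [hdu, hu, huv]
        by_cases hav : a = v
        · subst hav; simp [hdv, hv, huv.symm]
        simp [hdo a hau hav, hau, hav]
      simp only [M1, Nat.cast_sum, Nat.cast_pow, this, Finset.sum_add_distrib,
        Finset.sum_sub_distrib, Finset.sum_ite_eq', Finset.mem_univ, if_true]
      ring
    omega
  · set A := T.adjMatrix ℤ with hAdef
    set d : V → ℤ := fun a => deg T a with hddef
    set S : V → ℤ := fun a => ∑ b, A a b * d b with hS
    have hsymm : ∀ a b, A a b = A b a := fun a b => by simp [hAdef, adjMatrix_apply, adj_comm]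
    have key : (2 * M2 (swapEdge T u v y) : ℤ) =
        2 * M2 T + 2 * (S v - S u - A u v + 3 * d y) := by
      set δ : V → V → ℤ := fun x a => if a = x then 1 else 0 with hδ
      set d' : V → ℤ := fun a => deg (swapEdge T u v y) a with hd'
      have pick : ∀ (f : V → ℤ) x, ∑ a, f a * δ x a = f x := fun f x => by simp [hδ]
      have hd'' : ∀ a, d' a = d a - δ u a + δ v a := hd
      have hd'u : d' u = 1 := by simp [hd', hdu]
      have hd'v : d' v = 4 := by simp [hd', hdv]
      have hd'y : d' y = d y := by rw [hd'']; simp [hδ, huy.ne.symm, hvy.symm]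
      have hA' : ∀ a b, (swapEdge T u v y).adjMatrix ℤ a b =
        A a b - (δ u a * δ y b + δ y a * δ u b) + (δ v a * δ y b + δ y a * δ v b) := hA
      have hAuu : A u u = 0 := by simp [hAdef]
      have hAvv : A v v = 0 := by simp [hAdef]
      have hcol : ∀ x, ∑ a, d a * A a x = S x := fun x =>
        Finset.sum_congr rfl fun a _ => by rw [hsymm a x, mul_comm]
      have inner : ∀ a, ∑ b, (swapEdge T u v y).adjMatrix ℤ a b * (d' a * d' b) =
          d' a * (S a - A a u + A a v) + 3 * (d' a * δ y a)
            - d y * (d' a * δ u a) + d y * (d' a * δ v a) := by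
        intro a
        have : ∀ b, (swapEdge T u v y).adjMatrix ℤ a b * (d' a * d' b) =
            d' a * (A a b * d b) - d' a * (A a b * δ u b) + d' a * (A a b * δ v b)
            - (d' a * δ u a) * (d' b * δ y b) - (d' a * δ y a) * (d' b * δ u b)
            + (d' a * δ v a) * (d' b * δ y b) + (d' a * δ y a) * (d' b * δ v b) := by
          intro b
          rw [hA']
          linear_combination (d' a * A a b) * hd'' b
        simp only [this, Finset.sum_add_distrib, Finset.sum_sub_distrib, ← Finset.mul_sum, pick,
          hd'u, hd'v, hd'y]
        ring
      have outer : ∀ a, d' a * (S a - A a u + A a v) =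
          ∑ b, A a b * (d a * d b) - d a * A a u + d a * A a v
            - (S a - A a u + A a v) * δ u a + (S a - A a u + A a v) * δ v a := by
        intro a
        have : ∑ b, A a b * (d a * d b) = d a * S a := by
          rw [hS, Finset.mul_sum]
          exact Finset.sum_congr rfl fun b _ => by ring
        rw [this, hd'']
        ring
      rw [two_mul_M2, two_mul_M2]
      change ∑ a, ∑ b, (swapEdge T u v y).adjMatrix ℤ a b * (d' a * d' b) =
        ∑ a, ∑ b, A a b * (d a * d b) + _
      simp only [inner, outer, Finset.sum_add_distrib, Finset.sum_sub_distrib, ← Finset.mul_sum,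
        pick, hcol, hd'u, hd'v, hd'y, hAuu, hAvv, hsymm v u]
      ring
    have hA0 : ∀ a b, 0 ≤ A a b := fun a b => by
      simp only [hAdef, adjMatrix_apply]; split_ifs <;> simp
    have hSv : 3 ≤ S v := by
      have h3 : (3 : ℤ) = ∑ b, A v b := by rw [← deg_eq_sum, hv]; rfl
      rw [h3]
      refine Finset.sum_le_sum fun b _ => ?_
      have : (1 : ℤ) ≤ d b := Int.ofNat_le.mpr <| h1 b
      nlinarith [hA0 v b]
    have hSu : S u ≤ 4 + d y - A u v := by
      have h2 : (2 : ℤ) = ∑ b, A u b := by rw [← deg_eq_sum, hu]; rfl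
      have : S u ≤ ∑ b, (A u b * 4 - (if b = v then A u v else 0)
          + (if b = y then d y - 4 else 0)) := by
        refine Finset.sum_le_sum fun b _ => ?_
        have h4 : d b ≤ 4 := Int.ofNat_le.mpr <| hT.2 b
        have hdv3 : d v = 3 := by simp [hddef, hv]
        have huy1 : A u y = 1 := by simp [hAdef, huy]
        by_cases hbv : b = v
        · subst hbv; simp [hvy, hdv3]; linarith
        by_cases hby : b = y
        · subst hby; simp [hbv, huy1]
        · simp only [hbv, hby, if_false]; nlinarith [hA0 u b]
      simp only [Finset.sum_add_distrib, Finset.sum_sub_distrib, ← Finset.sum_mul, ← h2,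
        Finset.sum_ite_eq', Finset.mem_univ, if_true] at this
      linarith
    have hdy : (1 : ℤ) ≤ d y := Int.ofNat_le.mpr <| h1 y
    have : (M2 T : ℤ) < M2 (swapEdge T u v y) := by linarith
    exact_mod_cast this

end ChemTree

theorem stmt_13 {V : Type*} [Fintype V] (n b : ℕ)
    (hcard : Fintype.card V = n) (hb1 : 1 ≤ b) (hb2 : (b : ℚ) < (n : ℚ) / 2 - 1)
    (T : SimpleGraph V) (hT : IsChemicalTree T) (hbr : numBranching T = b)
    (hmax : (∀ T' : SimpleGraph V, IsChemicalTree T' → numBranching T' = b →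
        M1 T' ≤ M1 T) ∨
      (∀ T' : SimpleGraph V, IsChemicalTree T' → numBranching T' = b →
        M2 T' ≤ M2 T)) :
    (∃ v : V, deg T v = 2) ↔ (b : ℚ) < ((n : ℚ) - 2) / 3 := by
  subst hcard
  have hsum := sum_deg T hT.1
  have hbs := numBranching_eq_sum T
  rw [hbr] at hbs
  have hR : (b : ℚ) < ((Fintype.card V : ℚ) - 2) / 3 ↔ 3 * b + 2 < Fintype.card V := by
    rw [lt_div_iff₀ (by norm_num), lt_sub_iff_add_lt]
    norm_cast
    rw [mul_comm]
  rw [hR]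
  have hcard1 : ∑ v : V, (1 + 3 * if 3 ≤ deg T v then 1 else 0) = Fintype.card V + 3 * b := by
    rw [Finset.sum_add_distrib, ← Finset.mul_sum, ← hbs]
    simp
  constructor
  · rintro ⟨u, hu⟩
    by_cases h3 : ∃ v, deg T v = 3
    · obtain ⟨v, hv⟩ := h3
      obtain ⟨T', hT', hb', h1, h2⟩ := exists_larger_of_deg_two_of_deg_three hT hu hv
      rcases hmax with h | h
      · exact absurd (h T' hT' (hb'.trans hbr)) (by omega)
      · exact absurd (h T' hT' (hb'.trans hbr)) (by omega)
    · push Not at h3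
      have : Nontrivial V := by
        rw [← Fintype.one_lt_card_iff_nontrivial]
        have : (b : ℚ) + 1 < (Fintype.card V : ℚ) / 2 := by linarith
        have h' : ((b : ℚ) + 1) * 2 < Fintype.card V := by linarith
        norm_cast at h'
        omega
      have hlt : ∑ v : V, (1 + 3 * if 3 ≤ deg T v then 1 else 0) < ∑ v, deg T v := by
        refine Finset.sum_lt_sum (fun v _ => ?_) ⟨u, Finset.mem_univ u, by simp [hu]⟩
        have := one_le_deg hT.1.connected v
        have := h3 v
        split_ifs <;> omega
      omega
  · intro hlt
    by_contra! h2
    have hle : ∑ v, deg T v ≤ ∑ v : V, (1 + 3 * if 3 ≤ deg T v then 1 else 0) := by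
      refine Finset.sum_le_sum fun v _ => ?_
      have := hT.2 v
      have := h2 v
      split_ifs <;> omega
    omega
end

section
/- Let 1 ≤ b < n/2 − 1 and let T be an n-vertex chemical tree with exactly b branching vertices such that M2(T') ≤ M2(T) for every n-vertex chemical tree T' with exactly b branching vertices. Then T does not contain any internal path of length greater than 1. -/
open SimpleGraph

namespace ChemTree

variable {V : Type*}

/-- The sum over the edges of `G` of the products of the weights of the end vertices. -/
noncomputable def edgeWeight [Fintype V] (G : SimpleGraph V) (f : V → ℕ) : ℕ :=
  ∑ e ∈ (Set.toFinite G.edgeSet).toFinset,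
    Sym2.lift ⟨fun u w => f u * f w, fun _ _ => Nat.mul_comm _ _⟩ e

lemma edgeSet_sup_edge {G : SimpleGraph V} {i j : V} (hij : i ≠ j) :
    (G ⊔ edge i j).edgeSet = insert s(i, j) G.edgeSet := by
  ext e
  induction e with
  | _ x y =>
    simp only [mem_edgeSet, sup_adj, edge_adj, Set.mem_insert_iff, Sym2.eq_iff]
    grind [G.ne_of_adj]

lemma edgeWeight_sup_edge [Fintype V] {G : SimpleGraph V} {i j : V} (hij : i ≠ j)
    (h : ¬ G.Adj i j) (f : V → ℕ) :
    edgeWeight (G ⊔ edge i j) f = edgeWeight G f + f i * f j := by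
  classical
  have hE : (Set.toFinite (G ⊔ edge i j).edgeSet).toFinset =
      insert s(i, j) (Set.toFinite G.edgeSet).toFinset := by
    ext e
    simp [edgeSet_sup_edge hij]
  have hs : s(i, j) ∉ (Set.toFinite G.edgeSet).toFinset := by simpa using h
  rw [edgeWeight, hE, Finset.sum_insert hs, add_comm]
  rfl

lemma deg_sup_edge [Fintype V] [DecidableEq V] {G : SimpleGraph V} {i j : V} (hij : i ≠ j)
    (h : ¬ G.Adj i j) (z : V) :
    deg (G ⊔ edge i j) z = deg G z + ((if z = i then 1 else 0) + (if z = j then 1 else 0)) := by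
  have hji : ¬ G.Adj j i := fun h' => h h'.symm
  unfold deg
  by_cases hi : z = i
  · subst hi
    have : (G ⊔ edge z j).neighborSet z = insert j (G.neighborSet z) := by
      ext w
      simp only [mem_neighborSet, sup_adj, edge_adj, Set.mem_insert_iff]
      grind
    rw [this, Set.ncard_insert_of_notMem (by simpa using h)]
    simp [hij]
  · by_cases hj : z = j
    · subst hj
      have : (G ⊔ edge i z).neighborSet z = insert i (G.neighborSet z) := by
        ext w
        simp only [mem_neighborSet, sup_adj, edge_adj, Set.mem_insert_iff]
        grind
      rw [this, Set.ncard_insert_of_notMem (by simpa using hji)]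
      simp [hi]
    · have : (G ⊔ edge i j).neighborSet z = G.neighborSet z := by
        ext w
        simp only [mem_neighborSet, sup_adj, edge_adj]
        grind
      rw [this]
      simp [hi, hj]

lemma ncard_edgeSet_sup_edge [Finite V] {G : SimpleGraph V} {i j : V} (hij : i ≠ j)
    (h : ¬ G.Adj i j) : (G ⊔ edge i j).edgeSet.ncard = G.edgeSet.ncard + 1 := by
  rw [edgeSet_sup_edge hij, Set.ncard_insert_of_notMem (by simpa using h)]

lemma deleteEdges_sup_edge {G : SimpleGraph V} {i j : V} (h : G.Adj i j) :
    G.deleteEdges {s(i, j)} ⊔ edge i j = G := by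
  ext x y
  simp only [sup_adj, deleteEdges_adj, edge_adj, Set.mem_singleton_iff, Sym2.eq_iff]
  grind [G.ne_of_adj, G.adj_comm]

lemma edgeWeight_deleteEdges [Fintype V] {G : SimpleGraph V} {i j : V} (h : G.Adj i j)
    (f : V → ℕ) :
    edgeWeight G f = edgeWeight (G.deleteEdges {s(i, j)}) f + f i * f j := by
  rw [← edgeWeight_sup_edge h.ne (by simp), deleteEdges_sup_edge h]

lemma edgeWeight_congr [Fintype V] {G : SimpleGraph V} {f g : V → ℕ}
    (h : ∀ x y, G.Adj x y → f x = g x) : edgeWeight G f = edgeWeight G g := by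
  refine Finset.sum_congr rfl fun e he => ?_
  induction e with
  | _ x y =>
    have hxy : G.Adj x y := by simpa using he
    simp [h x y hxy, h y x hxy.symm]

/-- A nonempty set of vertices of a connected graph that is closed under adjacency is everything. -/
lemma mem_of_adj_closed {G : SimpleGraph V} (hG : G.Connected) {s : Set V}
    (hs : ∀ x ∈ s, ∀ y, G.Adj x y → y ∈ s) {x : V} (hx : x ∈ s) (y : V) : y ∈ s := by
  obtain ⟨p⟩ := hG.preconnected x y
  induction p with
  | nil => exact hx
  | cons h _ ih => exact ih (hs _ hx _ h)

/-- A tree with a branching vertex has a leaf whose neighbour is not a leaf. -/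
lemma exists_leaf [Fintype V] {T : SimpleGraph V} (hT : T.IsTree) {u : V} (hu : 3 ≤ deg T u) :
    ∃ x y, deg T x = 1 ∧ T.Adj x y ∧ (∀ z, T.Adj x z → z = y) ∧ 2 ≤ deg T y := by
  classical
  obtain ⟨w, hw⟩ : (T.neighborSet u).Nonempty := by
    rw [← Set.ncard_pos (Set.toFinite _)]
    exact (Nat.zero_lt_succ 2).trans_le hu
  have : Nontrivial V := ⟨u, w, T.ne_of_adj hw⟩
  have hdegree : ∀ w, T.degree w = deg T w := fun w => by
    rw [deg, ← card_neighborSet_eq_degree, ← Nat.card_coe_set_eq, Nat.card_eq_fintype_card]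
  obtain ⟨x, hx⟩ := hT.exists_vert_degree_one_of_nontrivial
  obtain ⟨y, hxy, hy⟩ := degree_eq_one_iff_existsUnique_adj.mp hx
  rw [hdegree] at hx
  refine ⟨x, y, hx, hxy, hy, ?_⟩
  by_contra! hlt
  have hyx : ∀ z, T.Adj y z → z = x := fun z hz =>
    (Set.ncard_le_one (Set.toFinite _)).mp (Nat.lt_succ_iff.mp hlt) z hz x hxy.symm
  have hmem := mem_of_adj_closed (s := {x, y}) hT.1
    (by rintro w (rfl | rfl) z hz <;> grind) (Set.mem_insert x _) u
  rcases hmem with rfl | rfl <;> lia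

/-- In a tree with an internal path from `u` to `v` whose set of internal vertices is `I`, with `a`
next to `u` and `c` next to `v`, join `u` to `v` and hang the internal vertices on a leaf. -/
lemma exists_M2_lt [Fintype V] {T : SimpleGraph V} (hT : IsChemicalTree T) {u v a c : V}
    {I : Set V} (hI : ∀ w ∈ I, deg T w = 2) (hu : 3 ≤ deg T u) (hv : 3 ≤ deg T v) (huv : u ≠ v)
    (hnadj : ¬ T.Adj u v) (ha : a ∈ I) (hc : c ∈ I) (hua : T.Adj u a) (hcv : T.Adj c v)
    (hN : ∀ w ∈ I, ∀ z, T.Adj w z → z ∈ I ∨ z = u ∨ z = v)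
    (hr : ((T.deleteEdges {s(u, a)}).deleteEdges {s(c, v)}).Reachable a c)
    (hq : a = c ∧ (∀ z, T.Adj c z → z = u ∨ z = v) ∨
      a ≠ c ∧ ∃ q ∈ I, T.Adj c q ∧ ∀ z, T.Adj c z → z = q ∨ z = v) :
    ∃ T' : SimpleGraph V, IsChemicalTree T' ∧ numBranching T' = numBranching T ∧
      M2 T < M2 T' := by
  classical
  obtain ⟨hTree, hdeg4⟩ := hT
  obtain ⟨x, y, hx, hxy, hy, hy2⟩ := exists_leaf hTree hu
  have huI : u ∉ I := fun h => by have := hI u h; lia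
  have hvI : v ∉ I := fun h => by have := hI v h; lia
  have hxI : x ∉ I := fun h => by have := hI x h; lia
  have hxu : x ≠ u := by rintro rfl; lia
  have hxv : x ≠ v := by rintro rfl; lia
  have hac : ∀ w ∈ I, w ≠ u ∧ w ≠ v ∧ w ≠ x := fun w hw => by grind
  have hxN : ∀ w ∈ I, ¬ T.Adj x w := fun w hw h => by grind [h.symm, hN w hw x h.symm]
  set T₁ := T.deleteEdges {s(u, a)} with hT₁
  set T₀ := T₁.deleteEdges {s(c, v)} with hT₀
  have hT₀adj : ∀ i j, T₀.Adj i j ↔ T.Adj i j ∧ s(i, j) ≠ s(u, a) ∧ s(i, j) ≠ s(c, v) := by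
    intro i j
    simp only [hT₀, hT₁, deleteEdges_adj, Set.mem_singleton_iff, and_assoc, Ne]
  have hT₁cv : T₁.Adj c v := by
    simp only [hT₁, deleteEdges_adj, Set.mem_singleton_iff, Sym2.eq_iff]
    grind
  have h₀cv : ¬ T₀.Adj c v := by simp [hT₀]
  have h₁ua : ¬ T₁.Adj u a := by simp [hT₁]
  have h₀uv : ¬ T₀.Adj u v := by grind
  have hxa : x ≠ a := (hac a ha).2.2.symm
  set T₂ := T₀ ⊔ edge u v with hT₂
  have h₂xa : ¬ T₂.Adj x a := by
    simp only [hT₂, sup_adj, edge_adj]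
    grind
  set T' := T₂ ⊔ edge x a with hT'
  have eT₁ : T₁ ⊔ edge u a = T := deleteEdges_sup_edge hua
  have eT₀ : T₀ ⊔ edge c v = T₁ := deleteEdges_sup_edge hT₁cv
  have hdT' : ∀ z, deg T' z + (if z = c then 1 else 0) = deg T z + (if z = x then 1 else 0) := by
    intro z
    rw [← eT₁, deg_sup_edge hua.ne h₁ua, ← eT₀, deg_sup_edge hcv.ne h₀cv, hT',
      deg_sup_edge hxa h₂xa, hT₂, deg_sup_edge huv h₀uv]
    ring
  have hcard : T'.edgeSet.ncard = T.edgeSet.ncard := by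
    rw [← eT₁, ncard_edgeSet_sup_edge hua.ne h₁ua, ← eT₀, ncard_edgeSet_sup_edge hcv.ne h₀cv, hT',
      ncard_edgeSet_sup_edge hxa h₂xa, hT₂, ncard_edgeSet_sup_edge huv h₀uv]
  have hle : T₀ ≤ T' := le_sup_left.trans le_sup_left
  have huv' : T'.Adj u v := by simp [hT', hT₂, edge_adj, huv]
  have hxa' : T'.Adj x a := by simp [hT', edge_adj, hxa]
  have hreach : ∀ z, z ∈ I ∨ T'.Reachable u z := by
    refine mem_of_adj_closed (s := {z | z ∈ I ∨ T'.Reachable u z}) hTree.1 ?_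
      (x := u) (Or.inr (Reachable.refl u))
    rintro z hz w hzw
    by_cases hwI : w ∈ I
    · exact Or.inl hwI
    rcases hz with hz | hz
    · rcases hN z hz w hzw with h | rfl | rfl
      · exact Or.inl h
      · exact Or.inr (Reachable.refl _)
      · exact Or.inr huv'.reachable
    · by_cases hzI : z ∈ I
      · rcases hN z hzI w hzw with h | rfl | rfl
        · exact Or.inl h
        · exact Or.inr (Reachable.refl _)
        · exact Or.inr huv'.reachable
      · refine Or.inr (hz.trans (Adj.reachable (hle ((hT₀adj z w).mpr ⟨hzw, ?_, ?_⟩))))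
        · rw [Ne, Sym2.eq_iff]; grind
        · rw [Ne, Sym2.eq_iff]; grind
  have hrx : T'.Reachable u x := (hreach x).resolve_left hxI
  have hra : T'.Reachable u a := hrx.trans hxa'.reachable
  have hrc : T'.Reachable u c := hra.trans (hr.mono hle)
  have hall : ∀ z, T'.Reachable u z := by
    refine mem_of_adj_closed (s := {z | T'.Reachable u z}) hTree.1 ?_ (x := u) (Reachable.refl u)
    rintro z hz w hzw
    by_cases h₀ : T₀.Adj z w
    · exact Reachable.trans hz (hle h₀).reachable
    · have h : s(z, w) = s(u, a) ∨ s(z, w) = s(c, v) := by grind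
      rw [Sym2.eq_iff, Sym2.eq_iff] at h
      rcases h with (⟨-, rfl⟩ | ⟨-, rfl⟩) | (⟨-, rfl⟩ | ⟨-, rfl⟩)
      · exact hra
      · exact Reachable.refl _
      · exact huv'.reachable
      · exact hrc
  have hTree' : T'.IsTree := by
    rw [isTree_iff_connected_and_card] at hTree ⊢
    have : Nonempty V := ⟨u⟩
    refine ⟨⟨fun i j => (hall i).symm.trans (hall j)⟩, ?_⟩
    rw [Nat.card_coe_set_eq, hcard, ← Nat.card_coe_set_eq]
    exact hTree.2
  have hcx : c ≠ x := (hac c hc).2.2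
  have hdc : deg T c = 2 := hI c hc
  have hdx' : deg T' x = 2 := by simpa [hcx.symm, hx] using hdT' x
  have hdc' : deg T' c = 1 := by simpa [hcx, hdc] using hdT' c
  have hd' : ∀ z, z ≠ c → z ≠ x → deg T' z = deg T z := fun z h₁ h₂ => by
    simpa [h₁, h₂] using hdT' z
  refine ⟨T', ⟨hTree', fun z => ?_⟩, ?_, ?_⟩
  · by_cases h₁ : z = c
    · subst h₁; lia
    by_cases h₂ : z = x
    · subst h₂; lia
    rw [hd' z h₁ h₂]; exact hdeg4 z
  · unfold numBranching
    congr 1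
    ext z
    by_cases h₁ : z = c
    · subst h₁; simp [hdc, hdc']
    by_cases h₂ : z = x
    · subst h₂; simp [hx, hdx']
    simp [hd' z h₁ h₂]
  · have e₁ : M2 T = edgeWeight T₀ (deg T) + deg T c * deg T v + deg T u * deg T a := by
      change edgeWeight T (deg T) = _
      rw [edgeWeight_deleteEdges hua, edgeWeight_deleteEdges hT₁cv]
    have e₂ : M2 T' = edgeWeight T₀ (deg T') + deg T' u * deg T' v + deg T' x * deg T' a := by
      change edgeWeight T' (deg T') = _
      rw [hT', edgeWeight_sup_edge hxa h₂xa, hT₂, edgeWeight_sup_edge huv h₀uv]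
    have h₀xy : T₀.Adj x y := by
      rw [hT₀adj, Ne, Ne, Sym2.eq_iff, Sym2.eq_iff]
      exact ⟨hxy, by grind⟩
    have hyI : y ∉ I := fun h => hxN y h hxy
    have hyc : y ≠ c := fun h => hyI (h ▸ hc)
    have e₃ := edgeWeight_deleteEdges h₀xy (deg T)
    have e₄ := edgeWeight_deleteEdges h₀xy (deg T')
    set T₃ := T₀.deleteEdges {s(x, y)} with hT₃
    have hT₃adj : ∀ i j, T₃.Adj i j ↔ T₀.Adj i j ∧ s(i, j) ≠ s(x, y) := by
      intro i j
      simp [hT₃, deleteEdges_adj]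
    have hx₃ : ∀ z, ¬ T₃.Adj x z := fun z hz => by
      have h := (hT₃adj x z).mp hz
      have hzy : z = y := hy z ((hT₀adj x z).mp h.1).1
      exact h.2 (hzy ▸ rfl)
    have hdu' := hd' u (hac c hc).1.symm hxu.symm
    have hdv' := hd' v (hac c hc).2.1.symm hxv.symm
    have hdy' := hd' y hyc hxy.ne'
    obtain ⟨s, hs⟩ := Nat.exists_eq_add_of_le hu
    obtain ⟨t, ht⟩ := Nat.exists_eq_add_of_le hv
    rcases hq with ⟨rfl, hq⟩ | ⟨hne, q, hqI, hcq, hq⟩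
    · have e₅ : edgeWeight T₃ (deg T') = edgeWeight T₃ (deg T) := by
        refine edgeWeight_congr fun i j hij => hd' i ?_ ?_
        · rintro rfl
          have h := (hT₀adj i j).mp ((hT₃adj i j).mp hij).1
          rcases hq j h.1 with rfl | rfl
          · exact h.2.1 Sym2.eq_swap
          · exact h.2.2 rfl
        · rintro rfl
          exact hx₃ j hij
      rw [e₁, e₂, e₃, e₄, e₅, hx, hdx', hdc, hdc', hdu', hdv', hdy', hs, ht]
      linarith [Nat.zero_le (s * t)]
    · have h₃qc : T₃.Adj c q := by
        rw [hT₃adj, hT₀adj, Ne, Ne, Ne, Sym2.eq_iff, Sym2.eq_iff, Sym2.eq_iff]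
        exact ⟨⟨hcq, by grind⟩, by grind⟩
      have e₆ := edgeWeight_deleteEdges h₃qc (deg T)
      have e₇ := edgeWeight_deleteEdges h₃qc (deg T')
      have e₅ : edgeWeight (T₃.deleteEdges {s(c, q)}) (deg T') =
          edgeWeight (T₃.deleteEdges {s(c, q)}) (deg T) := by
        refine edgeWeight_congr fun i j hij => ?_
        rw [deleteEdges_adj] at hij
        refine hd' i ?_ ?_
        · rintro rfl
          have h := (hT₀adj i j).mp ((hT₃adj i j).mp hij.1).1
          rcases hq j h.1 with rfl | rfl
          · exact hij.2 rfl
          · exact h.2.2 rfl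
        · rintro rfl
          exact hx₃ j hij.1
      have hdq' := hd' q hcq.ne' (hac q hqI).2.2
      have hda' := hd' a hne (hac a ha).2.2
      rw [e₁, e₂, e₃, e₄, e₆, e₇, e₅, hx, hdx', hdc, hdc', hdu', hdv', hdy', hdq', hda', hI a ha,
        hI q hqI, hs, ht]
      linarith [Nat.zero_le (s * t)]


end ChemTree

open ChemTree

theorem stmt_14 {V : Type*} [Fintype V] (n b : ℕ)
    (hcard : Fintype.card V = n) (hb1 : 1 ≤ b) (hb2 : (b : ℚ) < (n : ℚ) / 2 - 1)
    (T : SimpleGraph V) (hT : IsChemicalTree T) (hbr : numBranching T = b)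
    (hmax : ∀ T' : SimpleGraph V, IsChemicalTree T' → numBranching T' = b →
      M2 T' ≤ M2 T) :
    ∀ (u v : V) (p : T.Walk u v), IsInternalPath T p → p.length ≤ 1 := by
  classical
  rintro u v p ⟨hp, -, hu, hv, hint⟩
  by_contra! hlen
  have hinj : ∀ i j, i ≤ p.length → j ≤ p.length → p.getVert i = p.getVert j → i = j :=
    fun i j hi hj h => hp.getVert_injOn hi hj h
  have h0 : p.getVert 0 = u := p.getVert_zero
  have hl : p.getVert p.length = v := p.getVert_length
  have hdeg : ∀ i, 0 < i → i < p.length → deg T (p.getVert i) = 2 := fun i hi hi' =>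
    hint _ (p.getVert_mem_support i)
      (fun h => hi.ne' (hinj i 0 hi'.le (Nat.zero_le _) (h.trans h0.symm)))
      (fun h => hi'.ne (hinj i p.length hi'.le le_rfl (h.trans hl.symm)))
  have hnbr : ∀ i, 0 < i → i < p.length → ∀ z, T.Adj (p.getVert i) z →
      z = p.getVert (i - 1) ∨ z = p.getVert (i + 1) := by
    intro i hi hi' z hz
    have hprev : T.Adj (p.getVert i) (p.getVert (i - 1)) := by
      have := p.adj_getVert_succ (i := i - 1) (by lia)
      rw [Nat.sub_add_cancel hi] at this
      exact this.symm
    have hnext : T.Adj (p.getVert i) (p.getVert (i + 1)) := p.adj_getVert_succ hi'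
    have hne : p.getVert (i - 1) ≠ p.getVert (i + 1) := fun h => by
      have := hinj _ _ (by lia) (by lia) h
      lia
    have hsub : ({p.getVert (i - 1), p.getVert (i + 1)} : Set V) ⊆
        T.neighborSet (p.getVert i) := by
      rintro w (rfl | rfl)
      exacts [hprev, hnext]
    have heq := Set.eq_of_subset_of_ncard_le hsub
      (by rw [Set.ncard_pair hne]; exact (hdeg i hi hi').le) (Set.toFinite _)
    have hz' : z ∈ T.neighborSet (p.getVert i) := hz
    rwa [← heq] at hz'
  have huv : u ≠ v := fun h => by
    have := hinj 0 p.length (Nat.zero_le _) le_rfl (by rw [h0, hl, h])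
    lia
  have hnadj : ¬ T.Adj u v := fun h => by
    have hpath : (Walk.cons h Walk.nil).IsPath := by simp [huv]
    have := congrArg (fun q : T.Path u v => q.1.length)
      ((hT.1.2.subsingleton_path u v).elim ⟨p, hp⟩ ⟨_, hpath⟩)
    simp at this
    lia
  have hua : T.Adj u (p.getVert 1) := by
    simpa using p.adj_getVert_succ (i := 0) (by lia)
  have hcv : T.Adj (p.getVert (p.length - 1)) v := by
    have := p.adj_getVert_succ (i := p.length - 1) (by lia)
    rwa [Nat.sub_add_cancel (by lia), hl] at this
  have hne_u : ∀ i, 0 < i → i ≤ p.length → p.getVert i ≠ u := fun i hi hi' h =>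
    hi.ne' (hinj i 0 hi' (Nat.zero_le _) (h.trans h0.symm))
  have hne_v : ∀ i, i < p.length → p.getVert i ≠ v := fun i hi h =>
    hi.ne (hinj i p.length hi.le le_rfl (h.trans hl.symm))
  obtain ⟨T', hT', hbr', hlt⟩ := exists_M2_lt (a := p.getVert 1) (c := p.getVert (p.length - 1))
    (I := {w | ∃ i, 0 < i ∧ i < p.length ∧ p.getVert i = w}) hT
    (by rintro w ⟨i, hi, hi', rfl⟩; exact hdeg i hi hi') hu hv huv hnadj
    ⟨1, one_pos, hlen, rfl⟩ ⟨p.length - 1, by lia, by lia, rfl⟩ hua hcv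
    (by
      rintro w ⟨i, hi, hi', rfl⟩ z hz
      rcases hnbr i hi hi' z hz with rfl | rfl
      · rcases Nat.eq_zero_or_pos (i - 1) with h | h
        · exact Or.inr (Or.inl (h ▸ h0))
        · exact Or.inl ⟨i - 1, h, by lia, rfl⟩
      · rcases (Nat.succ_le_of_lt hi').eq_or_lt with h | h
        · exact Or.inr (Or.inr ((congrArg p.getVert h).trans hl))
        · exact Or.inl ⟨i + 1, by lia, h, rfl⟩)
    (by
      have hreach : ∀ i, i + 1 < p.length →
          ((T.deleteEdges {s(u, p.getVert 1)}).deleteEdges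
            {s(p.getVert (p.length - 1), v)}).Reachable (p.getVert 1) (p.getVert (i + 1)) := by
        intro i
        induction i with
        | zero => exact fun _ => Reachable.refl _
        | succ i ih =>
          intro hi
          refine (ih (by lia)).trans (Adj.reachable ?_)
          have h₁ := hne_u (i + 1) (by lia) (by lia)
          have h₂ := hne_u (i + 1 + 1) (by lia) (by lia)
          have h₃ := hne_v (i + 1) (by lia)
          have h₄ := hne_v (i + 1 + 1) (by lia)
          have h₅ := p.adj_getVert_succ (i := i + 1) (by lia)
          simp only [deleteEdges_adj, Set.mem_singleton_iff, Sym2.eq_iff]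
          tauto
      have := hreach (p.length - 2) (by lia)
      rwa [show p.length - 2 + 1 = p.length - 1 by lia] at this)
    (by
      have hc := hnbr (p.length - 1) (by lia) (by lia)
      rw [Nat.sub_add_cancel (by lia), hl] at hc
      rcases Nat.eq_or_lt_of_le hlen with h | h
      · refine Or.inl ⟨by rw [← h], fun z hz => ?_⟩
        have := hc z hz
        rwa [← h, show 1 + 1 - 1 - 1 = 0 from rfl, h0] at this
      · refine Or.inr ⟨fun h' => ?_, p.getVert (p.length - 1 - 1),
          ⟨p.length - 1 - 1, by lia, by lia, rfl⟩, ?_, hc⟩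
        · have := hinj _ _ (by lia) (by lia) h'
          lia
        · have := p.adj_getVert_succ (i := p.length - 1 - 1) (by lia)
          rw [Nat.sub_add_cancel (by lia)] at this
          exact this.symm)
  exact absurd (hmax T' hT' (hbr'.trans hbr)) hlt.not_ge
end
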